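/- There are infinitely many irreducible cubic polynomials f ∈ ℤ[x] such that f ∘ f is reducible in ℤ[x]. -/

import Mathlib

open Polynomial

/-- The family of cubics `n x³ + (2n-1) x² - (2n+1) x - n`. -/
noncomputable def famF (n : ℤ) : ℤ[X] :=
  C n * X ^ 3 + C (2 * n - 1) * X ^ 2 + C (-(2 * n + 1)) * X + C (-n)

/-- The cubic factor of `famF n ∘ famF n`. -/
noncomputable def famH (n : ℤ) : ℤ[X] :=
  C (n ^ 2) * X ^ 3 + C (2 * n ^ 2 - 2 * n) * X ^ 2 + C (-2 * n ^ 2 - 3 * n + 1) * X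
    + C (-(n ^ 2 - 2 * n - 1))

/-- The sextic factor of `famF n ∘ famF n`. -/
noncomputable def famK (n : ℤ) : ℤ[X] :=
  C (n ^ 2) * X ^ 6 + C (4 * n ^ 2 - n) * X ^ 5 + C (-2 * n) * X ^ 4
    + C (-10 * n ^ 2 + 2 * n - 1) * X ^ 3 + C (n - 1) * X ^ 2 + C (4 * n ^ 2 + 1) * X + C (n ^ 2)

lemma famF_comp (n : ℤ) : (famF n).comp (famF n) = famH n * famK n := by
  simp only [famF, famH, famK, add_comp, mul_comp, C_comp, X_comp, pow_comp]
  simp only [map_add, map_sub, map_mul, map_neg, map_pow, map_one, map_ofNat]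
  ring

lemma famH_natDegree (n : ℤ) (hn : n ≠ 0) : (famH n).natDegree = 3 :=
  natDegree_cubic (pow_ne_zero 2 hn)

lemma famK_natDegree (n : ℤ) (hn : n ≠ 0) : (famK n).natDegree = 6 := by
  unfold famK
  compute_degree!

lemma cubic_coeff (a b c d : ℤ) :
    (C a * X ^ 3 + C b * X ^ 2 + C c * X + C d : ℤ[X]).coeff 3 = a ∧
    (C a * X ^ 3 + C b * X ^ 2 + C c * X + C d : ℤ[X]).coeff 2 = b := by
  constructor <;> simp only [coeff_add, coeff_C_mul, coeff_X_pow, coeff_X, coeff_C] <;> norm_num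

lemma famF_primitive (n : ℤ) : (famF n).IsPrimitive := by
  intro r hr
  rw [C_dvd_iff_dvd_coeff] at hr
  have h3 := hr 3
  have h2 := hr 2
  rw [famF, (cubic_coeff _ _ _ _).1] at h3
  rw [famF, (cubic_coeff _ _ _ _).2] at h2
  have : r ∣ 1 := by
    have := dvd_sub (Dvd.dvd.mul_left h3 2) h2
    simpa using this
  exact isUnit_of_dvd_one this

lemma mod3 (m p q : ℤ) (h : (3 * m + 1) * p ^ 3 + (2 * (3 * m + 1) - 1) * p ^ 2 * q
    - (2 * (3 * m + 1) + 1) * p * q ^ 2 - (3 * m + 1) * q ^ 3 = 0) : (3 : ℤ) ∣ p ∧ (3 : ℤ) ∣ q := by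
  have h' := congrArg (Int.cast : ℤ → ZMod 3) h
  push_cast at h'
  have e3 : (3 : ZMod 3) = 0 := rfl
  rw [e3] at h'
  have key : ∀ a b : ZMod 3, (0 * (m : ZMod 3) + 1) * a ^ 3
      + (2 * (0 * (m : ZMod 3) + 1) - 1) * a ^ 2 * b
      - (2 * (0 * (m : ZMod 3) + 1) + 1) * a * b ^ 2 - (0 * (m : ZMod 3) + 1) * b ^ 3 = 0 →
      a = 0 ∧ b = 0 := by
    simp only [zero_mul, zero_add]
    decide
  obtain ⟨h1, h2⟩ := key _ _ h'
  exact ⟨(ZMod.intCast_zmod_eq_zero_iff_dvd p 3).1 h1, (ZMod.intCast_zmod_eq_zero_iff_dvd q 3).1 h2⟩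

lemma famF_natDegree (n : ℤ) (hn : n ≠ 0) : (famF n).natDegree = 3 := natDegree_cubic hn

lemma famF_irreducible (m : ℕ) : Irreducible (famF (3 * m + 1)) := by
  have hn : (3 * m + 1 : ℤ) ≠ 0 := by omega
  rw [IsPrimitive.Int.irreducible_iff_irreducible_map_cast (famF_primitive _)]
  have hdeg : ((famF (3 * m + 1)).map (Int.castRingHom ℚ)).natDegree = 3 := by
    rw [natDegree_map_eq_of_injective (RingHom.injective_int _), famF_natDegree _ hn]
  rw [irreducible_iff_roots_eq_zero_of_degree_le_three (by omega) (by omega)]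
  refine Multiset.eq_zero_of_forall_notMem fun x hx => ?_
  have hx0 := (mem_roots'.1 hx).2
  simp only [famF, IsRoot.def, eval_map, eval₂_add, eval₂_mul, eval₂_C, eval₂_X, eval₂_pow] at hx0
  simp only [eq_intCast] at hx0
  have hq : (x.den : ℚ) ≠ 0 := by exact_mod_cast x.den_nz
  have hxe : x * x.den = x.num := Rat.mul_den_eq_num x
  have hz := mod3 m x.num x.den (by
    have : (((3 * m + 1) * x.num ^ 3 + (2 * (3 * m + 1) - 1) * x.num ^ 2 * x.den
      - (2 * (3 * m + 1) + 1) * x.num * x.den ^ 2 - (3 * m + 1) * x.den ^ 3 : ℤ) : ℚ) = 0 := by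
      push_cast at hx0 ⊢
      rw [← hxe]
      linear_combination (x.den : ℚ) ^ 3 * hx0
    exact_mod_cast this)
  have hc := x.reduced
  have h1 : 3 ∣ x.num.natAbs := by have := hz.1; omega
  have h2 : 3 ∣ x.den := by have := hz.2; omega
  have := Nat.dvd_gcd h1 h2
  rw [hc] at this
  omega

theorem stmt_8 :
    {f : Polynomial ℤ | f.degree = 3 ∧ Irreducible f ∧
      ¬ IsUnit (f.comp f) ∧ ¬ Irreducible (f.comp f)}.Infinite := by
  refine Set.infinite_of_injective_forall_mem (f := fun m : ℕ => famF (3 * m + 1)) ?_ ?_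
  · intro a b hab
    have h := congrArg (fun p : ℤ[X] => p.coeff 3) hab
    simp only [famF, (cubic_coeff _ _ _ _).1] at h
    omega
  · intro m
    have hn : (3 * m + 1 : ℤ) ≠ 0 := by omega
    have hH : ¬ IsUnit (famH (3 * m + 1)) := fun h => by
      have := natDegree_eq_zero_of_isUnit h
      rw [famH_natDegree _ hn] at this
      omega
    have hK : ¬ IsUnit (famK (3 * m + 1)) := fun h => by
      have := natDegree_eq_zero_of_isUnit h
      rw [famK_natDegree _ hn] at this
      omega
    refine ⟨degree_cubic hn, famF_irreducible m, ?_, ?_⟩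
    · rw [famF_comp]
      exact fun h => hH (isUnit_of_mul_isUnit_left h)
    · rw [famF_comp]
      exact fun h => (h.isUnit_or_isUnit rfl).elim hH hK
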